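/- Let q be an odd prime with q ≤ 13 (i.e., q ∈ {3, 5, 7, 11, 13}) and let D be a regular design with q² runs, that is, a regular q^{n-m} design with n - m = 2, whose columns (the two independent columns x_1, x_2 and the m dependent columns c_{i1}x_1 + c_{i2}x_2 mod q) are pairwise linearly independent over Z_q. Then for every family of orthonormal polynomials on Z_q and every b ∈ Z_q^m, β_3(E_b) = 0 if and only if b = b*; that is, E_{b*} is the unique design with β_3 = 0 among all E_b's. -/

import Mathlib

open Finset Real

/-- The Williams transformation on natural-number representatives of `Z_q`:
`W(x) = 2x` if `0 ≤ x < q/2` and `W(x) = 2(q-x) - 1` if `q/2 ≤ x < q`. -/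
def Wnat (q x : ℕ) : ℕ := if 2 * x < q then 2 * x else 2 * (q - x) - 1

/-- The Williams transformation on `ZMod q`, applied to the canonical
representative in `{0, 1, ..., q-1}`. -/
def Wz (q : ℕ) (x : ZMod q) : ZMod q := (Wnat q x.val : ZMod q)

/-- `γ = (q-1)/4` if `q ≡ 1 (mod 4)` and `γ = (3q-1)/4` if `q ≡ 3 (mod 4)`. -/
def gammaNat (q : ℕ) : ℕ := if q % 4 = 1 then (q - 1) / 4 else (3 * q - 1) / 4

/-- The regular `q^{n-m}` design with `k = n - m` independent columns and `m` dependent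
columns with generator coefficients `c`.  Rows are indexed by the full factorial
`Fin k → ZMod q`; columns are indexed by `Fin k ⊕ Fin m`, where `Sum.inl j` is the
independent column `x_j` and `Sum.inr i` is the dependent column `∑ j, c i j * x_j`. -/
def regDesign {q k m : ℕ} (c : Fin m → Fin k → ZMod q) :
    (Fin k → ZMod q) → Fin k ⊕ Fin m → ZMod q :=
  fun x => Sum.elim x fun i => ∑ j, c i j * x j

/-- The design `D_b`, obtained from the regular design by adding `b_i` to the `i`-th
dependent column. -/
def regDesignB {q k m : ℕ} (c : Fin m → Fin k → ZMod q) (b : Fin m → ZMod q) :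
    (Fin k → ZMod q) → Fin k ⊕ Fin m → ZMod q :=
  fun x => Sum.elim x fun i => (∑ j, c i j * x j) + b i

/-- The design `E_b = W(D_b)`, obtained by applying the Williams transformation to
every entry of `D_b`. -/
def Eb {q k m : ℕ} (c : Fin m → Fin k → ZMod q) (b : Fin m → ZMod q) :
    (Fin k → ZMod q) → Fin k ⊕ Fin m → ZMod q :=
  fun x col => Wz q (regDesignB c b x col)

/-- The permutation vector `b*` with `b*_i = (1 - ∑ j, c i j) * γ (mod q)`. -/
def bstar {q k m : ℕ} (c : Fin m → Fin k → ZMod q) : Fin m → ZMod q :=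
  fun i => (1 - ∑ j, c i j) * (gammaNat q : ZMod q)

/-- A family of orthonormal polynomials on `Z_q`: `p_0 ≡ 1`, `p_j` has degree exactly
`j` for `j < q`, and `∑_{x=0}^{q-1} p_i(x) p_j(x)` equals `q` if `i = j` and `0`
otherwise. -/
def IsOrthonormalFamily (q : ℕ) (p : ℕ → Polynomial ℝ) : Prop :=
  p 0 = 1 ∧ (∀ j < q, (p j).degree = j) ∧
    ∀ i < q, ∀ j < q,
      (∑ x ∈ Finset.range q, (p i).eval (x : ℝ) * (p j).eval (x : ℝ)) =
        if i = j then (q : ℝ) else 0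

/-- The `β`-wordlength pattern value
`β_k(A) = N⁻² ∑_{u : u₁+⋯+uₙ = k} (∑ᵢ ∏ⱼ p_{uⱼ}(aᵢⱼ))²`. -/
noncomputable def betaWL {Row Col : Type*} [Fintype Row] [Fintype Col] [DecidableEq Col]
    (q : ℕ) (p : ℕ → Polynomial ℝ) (k : ℕ) (A : Row → Col → ZMod q) : ℝ :=
  ((Fintype.card Row : ℝ) ^ 2)⁻¹ *
    ∑ u ∈ Finset.univ.filter (fun u : Col → Fin q => (∑ j, (u j : ℕ)) = k),
      (∑ i : Row, ∏ j : Col, (p (u j : ℕ)).eval ((A i j).val : ℝ)) ^ 2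

/-- The coefficient vector (over the two independent columns) of each column of a
regular design with `q²` runs: the independent column `x_j` has coefficient vector
`e_j` and the dependent column `c_{i1}x_1 + c_{i2}x_2` has coefficient vector
`(c_{i1}, c_{i2})`. -/
def coeffVec {q m : ℕ} (c : Fin m → Fin 2 → ZMod q) :
    Fin 2 ⊕ Fin m → Fin 2 → ZMod q :=
  Sum.elim (fun j => Pi.single j 1) c

/-- Centered Williams value, as an integer. -/
def wI (q x : ℕ) : ℤ := 2 * (Wnat q x : ℤ) - ((q : ℤ) - 1)

/-- Kernel-friendly sums. -/
def sumZ (f : ℕ → ℤ) (n : ℕ) : ℤ := Nat.rec 0 (fun k s => s + f k) n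

def sumN (f : ℕ → ℕ) (n : ℕ) : ℕ := Nat.rec 0 (fun k s => s + f k) n

/-- Lookup in a table packed in base `2048`. -/
def tab (T q d s : ℕ) : ℕ := T / 2 ^ (11 * (q * d + s)) % 2048

/-- Branch-free Williams value. -/
def Wfast (q x : ℕ) : ℕ := 2 * x + 2 * x / q * (2 * q - 1) - 4 * x * (2 * x / q)

/-- The packed table contains the inner sums, shifted by `1024`. -/
def chkA (T q : ℕ) : Prop := ∀ d < q, ∀ s < q,
  sumZ (fun y => wI q y * wI q ((d * y + s) % q)) q = (tab T q d s : ℤ) - 1024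

/-- Nonvanishing of the triple sums away from the distinguished shift. -/
def chkB (T q : ℕ) : Prop := ∀ c < q, ∀ d < q, ∀ b < q,
  c = 0 ∨ d = 0 ∨ (b + (c + d) * gammaNat q) % q = gammaNat q % q ∨
  sumN (fun x => 2 * Wfast q x * tab T q d ((c * x + b) % q)) q ≠
    sumN (fun x => (q - 1) * tab T q d ((c * x + b) % q)) q

instance (T q : ℕ) : Decidable (chkA T q) := by unfold chkA; infer_instance
instance (T q : ℕ) : Decidable (chkB T q) := by unfold chkB; infer_instance

def tbl3 : ℕ :=
  318304199565212745506156971008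

theorem chkA3 : chkA tbl3 3 := by decide +kernel

theorem chkB3 : chkB tbl3 3 := by decide +kernel

def tbl5 : ℕ :=
  31317424893151742320043246545713788605211935344448905081352775451368912389553521664

theorem chkA5 : chkA tbl5 5 := by decide +kernel

theorem chkB5 : chkB tbl5 5 := by decide +kernel

def tbl7 : ℕ :=
  988102013577519997531324547073993994454764944649265017683151618569193204815882316278133488321167571602152316620835536806937914448935033335249310557448544515523584

theorem chkA7 : chkA tbl7 7 := by decide +kernel

theorem chkB7 : chkB tbl7 7 := by decide +kernel

def tbl11 : ℕ :=
  33063818131708022770315122518379275595474108028828543041309332756979457255310215527393111804729610890014302909569874967205240467358416384914747402326217697687922174083463463908192535207553899432369436398548086219145147515979904408810266932488068267676632578240898269160206631004578184092499326983189786470528280519008895535346228471231382319025365181226266515200201652534757108113708798785075799917568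

theorem chkA11 : chkA tbl11 11 := by decide +kernel

theorem chkB11 : chkB tbl11 11 := by decide +kernel

def tbl13 : ℕ :=
  34766959339474324119979960642161373391201000629662320773227228182141906132020805419421642071205250751596269875507067846205893022032752752848974149543946164104001301192934918456518128674377787180363526511666282890292947090526627269615497314223827924961316146689730683443148608238023059319771658113764229372771889426559896506046446039613342868129016771255856187245466211004025378034161357813226833779459974459656495014627784848943358807762973606949668651741979142050159472689993062714854827537701822012407462095754729772954744776223070144746107734065984017794048

theorem chkA13 : chkA tbl13 13 := by decide +kernel

theorem chkB13 : chkB tbl13 13 := by decide +kernel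

theorem sumZ_eq (f : ℕ → ℤ) (n : ℕ) : sumZ f n = ∑ x ∈ Finset.range n, f x := by
  induction n with
  | zero => rfl
  | succ k ih => rw [Finset.sum_range_succ, ← ih]; rfl

theorem sumN_eq (f : ℕ → ℕ) (n : ℕ) : sumN f n = ∑ x ∈ Finset.range n, f x := by
  induction n with
  | zero => rfl
  | succ k ih => rw [Finset.sum_range_succ, ← ih]; rfl

/-- Facts about a specific `q` which are checked by computation. -/
structure QFacts (q : ℕ) : Prop where
  sumw : sumZ (wI q) q = 0
  fast : ∀ x < q, Wfast q x = Wnat q x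
  lt : ∀ x < q, Wnat q x < q
  refl : ∀ x < q, Wnat q ((2 * gammaNat q + (q - x)) % q) + Wnat q x + 1 = q
  tabs : ∃ T, chkA T q ∧ chkB T q

theorem qfacts (q : ℕ) (hq : q.Prime) (hodd : Odd q) (hq13 : q ≤ 13) : QFacts q := by
  have h : q = 3 ∨ q = 5 ∨ q = 7 ∨ q = 11 ∨ q = 13 := by
    interval_cases q <;> first | (exfalso; revert hq; norm_num; done) | (exfalso; revert hodd; decide) | simp
  rcases h with rfl | rfl | rfl | rfl | rfl
  · exact ⟨by decide +kernel, by decide +kernel, by decide +kernel, by decide +kernel, _, chkA3, chkB3⟩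
  · exact ⟨by decide +kernel, by decide +kernel, by decide +kernel, by decide +kernel, _, chkA5, chkB5⟩
  · exact ⟨by decide +kernel, by decide +kernel, by decide +kernel, by decide +kernel, _, chkA7, chkB7⟩
  · exact ⟨by decide +kernel, by decide +kernel, by decide +kernel, by decide +kernel, _, chkA11, chkB11⟩
  · exact ⟨by decide +kernel, by decide +kernel, by decide +kernel, by decide +kernel, _, chkA13, chkB13⟩

/-- Nonvanishing of the triple sum. -/
theorem triple_ne {q : ℕ} (h : QFacts q) (c d b : ℕ) (hc : c < q) (hd : d < q) (hb : b < q)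
    (hc0 : c ≠ 0) (hd0 : d ≠ 0)
    (hS : ∑ x ∈ Finset.range q, ∑ y ∈ Finset.range q,
      wI q x * wI q y * wI q ((c * x + d * y + b) % q) = 0) :
    (b + (c + d) * gammaNat q) % q = gammaNat q % q := by
  obtain ⟨T, hA, hB⟩ := h.tabs
  have hw := h.sumw
  rw [sumZ_eq] at hw
  rcases hB c hc d hd b hb with h1 | h1 | h1 | h1
  · exact absurd h1 hc0
  · exact absurd h1 hd0
  · exact h1
  · exfalso
    apply h1
    have hq0 : 0 < q := by omega
    have e1 : ∀ x ∈ Finset.range q, ∑ y ∈ Finset.range q,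
        wI q x * wI q y * wI q ((c * x + d * y + b) % q) =
        ((2 * Wfast q x * tab T q d ((c * x + b) % q) : ℕ) : ℤ)
          - (((q - 1) * tab T q d ((c * x + b) % q) : ℕ) : ℤ) - 1024 * wI q x := by
      intro x hx
      have := hA d hd ((c * x + b) % q) (Nat.mod_lt _ hq0)
      rw [sumZ_eq] at this
      have e2 : ∀ y, (d * y + (c * x + b) % q) % q = (c * x + d * y + b) % q := by
        intro y
        rw [Nat.add_mod_mod]
        congr 1
        ring
      simp only [e2] at this
      simp only [mul_assoc]
      rw [← Finset.mul_sum, this, h.fast x (Finset.mem_range.1 hx)]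
      push_cast [Nat.cast_sub (show 1 ≤ q from hq0)]
      unfold wI
      ring
    rw [Finset.sum_congr rfl e1, Finset.sum_sub_distrib, Finset.sum_sub_distrib,
      ← Finset.mul_sum, hw] at hS
    rw [sumN_eq, sumN_eq]
    have : ((∑ x ∈ Finset.range q, 2 * Wfast q x * tab T q d ((c * x + b) % q) : ℕ) : ℤ) =
      ((∑ x ∈ Finset.range q, (q - 1) * tab T q d ((c * x + b) % q) : ℕ) : ℤ) := by
      push_cast at hS ⊢
      linarith
    exact_mod_cast this

theorem sum_zmod {q : ℕ} [NeZero q] {M : Type*} [AddCommMonoid M] (f : ℕ → M) :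
    ∑ x : ZMod q, f x.val = ∑ x ∈ Finset.range q, f x := by
  refine Finset.sum_bij (fun x _ => x.val) ?_ ?_ ?_ ?_
  · intro x _; exact Finset.mem_range.2 (ZMod.val_lt x)
  · intro x _ y _ h; exact ZMod.val_injective q h
  · intro x hx; exact ⟨(x : ZMod q), Finset.mem_univ _, ZMod.val_natCast_of_lt (Finset.mem_range.1 hx)⟩
  · intros; rfl

theorem Wz_val {q : ℕ} [NeZero q] (h : QFacts q) (x : ZMod q) : (Wz q x).val = Wnat q x.val :=
  ZMod.val_natCast_of_lt (h.lt _ (ZMod.val_lt x))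

theorem Wz_refl {q : ℕ} [NeZero q] (h : QFacts q) (x : ZMod q) :
    ((Wz q (2 * (gammaNat q : ZMod q) - x)).val : ℝ) = (q : ℝ) - 1 - ((Wz q x).val : ℝ) := by
  rw [Wz_val h, Wz_val h]
  have h1 := h.refl x.val (ZMod.val_lt x)
  have h2 : (2 * (gammaNat q : ZMod q) - x).val = (2 * gammaNat q + (q - x.val)) % q := by
    rw [← ZMod.val_natCast]
    congr 1
    push_cast [Nat.cast_sub (ZMod.val_lt x).le]
    simp [sub_eq_add_neg]
  rw [h2]
  have : ((Wnat q ((2 * gammaNat q + (q - x.val)) % q) + Wnat q x.val + 1 : ℕ) : ℝ) = (q : ℝ) := by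
    rw [h1]
  push_cast at this
  linarith

/-- Members of an orthonormal family are orthogonal to all lower-degree polynomials. -/
theorem orth_lower {q : ℕ} {p : ℕ → Polynomial ℝ} (hp : IsOrthonormalFamily q p) (j : ℕ) (hj : j < q) :
    ∀ d ≤ j, ∀ r : Polynomial ℝ, r.degree < d →
      ∑ x ∈ Finset.range q, (p j).eval (x : ℝ) * r.eval (x : ℝ) = 0 := by
  intro d
  induction d with
  | zero =>
    intro _ r hr
    have : r = 0 := by
      rw [← Polynomial.degree_eq_bot]
      simpa [Nat.WithBot.lt_zero_iff] using hr
    simp [this]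
  | succ d ih =>
    intro hd r hr
    have hdeg := hp.2.1 d (by omega)
    have hlc : (p d).coeff d ≠ 0 := by
      have := Polynomial.coeff_ne_zero_of_eq_degree hdeg
      exact this
    set a := r.coeff d / (p d).coeff d with ha
    have h1 := ih (by omega) (r - Polynomial.C a * p d) (by
      rw [Polynomial.degree_lt_iff_coeff_zero] at hr ⊢
      intro k hk
      rcases Nat.eq_or_lt_of_le hk with rfl | hk
      · simp [ha, hlc]
      · rw [Polynomial.coeff_sub, Polynomial.coeff_C_mul, hr k hk,
          Polynomial.coeff_eq_zero_of_degree_lt (by rw [hdeg]; exact_mod_cast hk)]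
        simp)
    have h2 := hp.2.2 j hj d (by omega)
    rw [if_neg (by omega)] at h2
    have : ∀ x ∈ Finset.range q, (p j).eval (x : ℝ) * r.eval (x : ℝ) =
        (p j).eval (x : ℝ) * (r - Polynomial.C a * p d).eval (x : ℝ)
        + a * ((p j).eval (x : ℝ) * (p d).eval (x : ℝ)) := by
      intro x _
      simp
      ring
    rw [Finset.sum_congr rfl this, Finset.sum_add_distrib, h1, ← Finset.mul_sum, h2]
    simp

theorem p_symm {q : ℕ} {p : ℕ → Polynomial ℝ} (hp : IsOrthonormalFamily q p) (j : ℕ) (hj : j < q)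
    (x : ℕ) (hx : x < q) :
    (p j).eval ((q : ℝ) - 1 - x) = (-1) ^ j * (p j).eval (x : ℝ) := by
  set l : Polynomial ℝ := Polynomial.C ((q : ℝ) - 1) - Polynomial.X with hl
  set r : Polynomial ℝ := (p j).comp l - Polynomial.C ((-1) ^ j) * p j with hr
  have hdegj := hp.2.1 j hj
  have hnat : (p j).natDegree = j := Polynomial.natDegree_eq_of_degree_eq_some hdegj
  have hlX : l = -(Polynomial.X - Polynomial.C ((q : ℝ) - 1)) := by rw [hl]; ring
  have hlnat : l.natDegree = 1 := by
    rw [hlX, Polynomial.natDegree_neg, Polynomial.natDegree_X_sub_C]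
  have hllc : l.leadingCoeff = -1 := by
    rw [hlX, Polynomial.leadingCoeff_neg, Polynomial.leadingCoeff_X_sub_C]
  have hcn : ∀ s : Polynomial ℝ, (s.comp l).natDegree = s.natDegree := by
    intro s; rw [Polynomial.natDegree_comp, hlnat, mul_one]
  have hrdeg : r.degree < j := by
    rw [Polynomial.degree_lt_iff_coeff_zero]
    intro k hk
    rw [hr, Polynomial.coeff_sub, Polynomial.coeff_C_mul]
    rcases Nat.eq_or_lt_of_le hk with rfl | hk
    · have h1 : ((p j).comp l).coeff j = ((p j).comp l).leadingCoeff := by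
        rw [Polynomial.leadingCoeff, hcn, hnat]
      rw [h1, Polynomial.leadingCoeff_comp (by rw [hlnat]; simp), hllc, hnat,
        Polynomial.leadingCoeff, hnat]
      ring
    · rw [Polynomial.coeff_eq_zero_of_natDegree_lt (by rw [hcn, hnat]; exact hk),
        Polynomial.coeff_eq_zero_of_natDegree_lt (by rw [hnat]; exact hk)]
      simp
  have hleval : ∀ x < q, l.eval (x : ℝ) = ((q - 1 - x : ℕ) : ℝ) := by
    intro x hx
    rw [Nat.cast_sub (by omega), Nat.cast_sub (by omega)]
    simp [hl]
  have hrl : (r.comp l).degree < j := by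
    rcases eq_or_ne r 0 with h0 | h0
    · rw [h0] at hrdeg ⊢; simpa using hrdeg
    · have h2 : r.natDegree < j := (Polynomial.natDegree_lt_iff_degree_lt h0).2 hrdeg
      refine lt_of_le_of_lt Polynomial.degree_le_natDegree ?_
      rw [hcn]
      exact_mod_cast h2
  have o1 := orth_lower hp j hj j le_rfl r hrdeg
  have o2 := orth_lower hp j hj j le_rfl _ hrl
  rw [← Finset.sum_range_reflect] at o2
  have hz : ∑ x ∈ Finset.range q, r.eval (x : ℝ) * r.eval (x : ℝ) = 0 := by
    have : ∀ x ∈ Finset.range q, r.eval (x : ℝ) * r.eval (x : ℝ) =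
        (p j).eval ((q - 1 - x : ℕ) : ℝ) * (r.comp l).eval ((q - 1 - x : ℕ) : ℝ)
        - (-1) ^ j * ((p j).eval (x : ℝ) * r.eval (x : ℝ)) := by
      intro x hx
      have hx := Finset.mem_range.1 hx
      rw [Polynomial.eval_comp, hleval _ (by omega)]
      have e : q - 1 - (q - 1 - x) = x := by omega
      rw [e]
      conv_lhs => rw [hr]
      rw [Polynomial.eval_sub, Polynomial.eval_comp, hleval x hx, Polynomial.eval_mul,
        Polynomial.eval_C]
      ring
    rw [Finset.sum_congr rfl this, Finset.sum_sub_distrib, o2, ← Finset.mul_sum, o1]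
    simp
  rw [Finset.sum_eq_zero_iff_of_nonneg (fun _ _ => mul_self_nonneg _)] at hz
  have h3 := mul_self_eq_zero.1 (hz x (Finset.mem_range.2 hx))
  rw [hr, Polynomial.eval_sub, Polynomial.eval_comp, Polynomial.eval_mul, Polynomial.eval_C] at h3
  have h4 : l.eval (x : ℝ) = (q : ℝ) - 1 - x := by simp [hl]
  rw [h4] at h3
  linarith

theorem beta_zero {q m : ℕ} [NeZero q] (h : QFacts q) (c : Fin m → Fin 2 → ZMod q)
    (p : ℕ → Polynomial ℝ) (hp : IsOrthonormalFamily q p) :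
    betaWL q p 3 (Eb c (bstar c)) = 0 := by
  unfold betaWL
  refine mul_eq_zero_of_right _ (Finset.sum_eq_zero ?_)
  intro u hu
  have hu := (Finset.mem_filter.1 hu).2
  set g : ZMod q := (gammaNat q : ZMod q) with hg
  let e : (Fin 2 → ZMod q) ≃ (Fin 2 → ZMod q) := Equiv.subLeft (fun _ => 2 * g)
  have hcol : ∀ x col, regDesignB c (bstar c) (e x) col = 2 * g - regDesignB c (bstar c) x col := by
    intro x col
    rcases col with j | i
    · rfl
    · simp only [regDesignB, Sum.elim_inr, bstar, e, Equiv.subLeft_apply, Pi.sub_apply,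
        Fin.sum_univ_two, ← hg]
      ring
  have hterm : ∀ x, ∏ j, (p (u j : ℕ)).eval ((Eb c (bstar c) (e x) j).val : ℝ) =
      - ∏ j, (p (u j : ℕ)).eval ((Eb c (bstar c) x j).val : ℝ) := by
    intro x
    have : ∀ j, (p (u j : ℕ)).eval ((Eb c (bstar c) (e x) j).val : ℝ) =
        (-1) ^ (u j : ℕ) * (p (u j : ℕ)).eval ((Eb c (bstar c) x j).val : ℝ) := by
      intro j
      unfold Eb
      rw [hcol, Wz_refl h, p_symm hp _ (u j).2 _ (ZMod.val_lt _)]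
    rw [Finset.prod_congr rfl (fun j _ => this j), Finset.prod_mul_distrib,
      Finset.prod_pow_eq_pow_sum, hu]
    norm_num
  have hs := Equiv.sum_comp e (fun x => ∏ j, (p (u j : ℕ)).eval ((Eb c (bstar c) x j).val : ℝ))
  rw [Finset.sum_congr rfl (fun x _ => hterm x), Finset.sum_neg_distrib] at hs
  have : ∑ x, ∏ j, (p (u j : ℕ)).eval ((Eb c (bstar c) x j).val : ℝ) = 0 := by linarith
  rw [this]
  norm_num

theorem p_one {q : ℕ} {p : ℕ → Polynomial ℝ} (hp : IsOrthonormalFamily q p) (hq : 1 < q) :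
    ∃ a : ℝ, a ≠ 0 ∧ ∀ x : ℝ, (p 1).eval x = a * (2 * x - ((q : ℝ) - 1)) := by
  have hdeg := hp.2.1 1 hq
  have hs := p_symm hp 1 hq 0 (by omega)
  have hlc : (p 1).coeff 1 ≠ 0 := Polynomial.coeff_ne_zero_of_eq_degree hdeg
  have hX := Polynomial.eq_X_add_C_of_degree_le_one (le_of_eq hdeg)
  have hev : ∀ x, (p 1).eval x = (p 1).coeff 1 * x + (p 1).coeff 0 := by
    intro x
    conv_lhs => rw [hX]
    simp
  refine ⟨(p 1).coeff 1 / 2, by simpa using hlc, fun x => ?_⟩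
  rw [hev, hev] at hs
  rw [hev]
  simp at hs
  linarith

theorem beta_conv {q m : ℕ} [NeZero q] (h : QFacts q) (hq : 1 < q) (c : Fin m → Fin 2 → ZMod q)
    (hc : ∀ i j, c i j ≠ 0)
    (p : ℕ → Polynomial ℝ) (hp : IsOrthonormalFamily q p) (b : Fin m → ZMod q)
    (hb : betaWL q p 3 (Eb c b) = 0) : b = bstar c := by
  unfold betaWL at hb
  have hN : ((Fintype.card (Fin 2 → ZMod q) : ℝ) ^ 2)⁻¹ ≠ 0 := by
    have : (Fintype.card (Fin 2 → ZMod q)) ≠ 0 := Fintype.card_ne_zero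
    positivity
  have hb := (mul_eq_zero.1 hb).resolve_left hN
  rw [Finset.sum_eq_zero_iff_of_nonneg (fun _ _ => sq_nonneg _)] at hb
  obtain ⟨a, ha, hp1⟩ := p_one hp hq
  funext i
  let u : Fin 2 ⊕ Fin m → Fin q :=
    Sum.elim (fun _ => ⟨1, hq⟩) (fun k => if k = i then ⟨1, hq⟩ else ⟨0, by omega⟩)
  have hui : ∀ k, ((u (Sum.inr k) : Fin q) : ℕ) = if k = i then 1 else 0 := by
    intro k
    simp only [u, Sum.elim_inr]
    split_ifs <;> rfl
  have hul : ∀ k, ((u (Sum.inl k) : Fin q) : ℕ) = 1 := fun _ => rfl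
  have hu : u ∈ Finset.univ.filter (fun u : Fin 2 ⊕ Fin m → Fin q => (∑ j, (u j : ℕ)) = 3) := by
    rw [Finset.mem_filter]
    refine ⟨Finset.mem_univ _, ?_⟩
    rw [Fintype.sum_sum_type]
    simp [hui, hul]
  have h1 := pow_eq_zero_iff (two_ne_zero) |>.1 (hb u hu)
  have hterm : ∀ x : Fin 2 → ZMod q, ∏ j, (p (u j : ℕ)).eval ((Eb c b x j).val : ℝ) =
      a ^ 3 * ((wI q (x 0).val * wI q (x 1).val *
        wI q (((c i 0).val * (x 0).val + (c i 1).val * (x 1).val + (b i).val) % q) : ℤ) : ℝ) := by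
    intro x
    rw [Fintype.prod_sum_type, Finset.prod_eq_single i]
    · have hv : ((c i 0).val * (x 0).val + (c i 1).val * (x 1).val + (b i).val) % q =
          (c i 0 * x 0 + c i 1 * x 1 + b i).val := by
        rw [← ZMod.val_natCast]
        congr 1
        push_cast
        simp
      rw [hv]
      simp only [hui, hul, if_true, Fin.prod_univ_two, hp1, Eb, Wz_val h, regDesignB,
        Sum.elim_inl, Sum.elim_inr, Fin.sum_univ_two, wI]
      push_cast
      ring
    · intro k _ hk
      rw [hui, if_neg hk, hp.1]
      simp
    · simp
  rw [Finset.sum_congr rfl (fun x _ => hterm x), ← Finset.mul_sum] at h1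
  have h2 := (mul_eq_zero.1 h1).resolve_left (pow_ne_zero 3 ha)
  rw [← Int.cast_sum] at h2
  have h3 := Int.cast_eq_zero.1 h2
  rw [← Equiv.sum_comp (finTwoArrowEquiv (ZMod q)).symm, Fintype.sum_prod_type] at h3
  simp only [finTwoArrowEquiv_symm_apply, Matrix.cons_val_zero, Matrix.cons_val_one] at h3
  have h4 : ∑ x ∈ Finset.range q, ∑ y ∈ Finset.range q,
      wI q x * wI q y * wI q (((c i 0).val * x + (c i 1).val * y + (b i).val) % q) = 0 := by
    rw [← h3, ← sum_zmod]
    refine Finset.sum_congr rfl fun x _ => ?_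
    rw [← sum_zmod]
  have h5 := triple_ne h _ _ _ (ZMod.val_lt _) (ZMod.val_lt _) (ZMod.val_lt _)
    (by simpa using hc i 0) (by simpa using hc i 1) h4
  have h6 := (ZMod.natCast_eq_natCast_iff' _ _ q).2 h5
  push_cast at h6
  simp only [ZMod.natCast_val, ZMod.cast_id', id_eq] at h6
  simp only [bstar, Fin.sum_univ_two]
  linear_combination h6

/-- Corollary 1: For an odd prime `q ≤ 13` and a regular design with
`q²` runs (i.e. `n - m = 2`) whose columns are pairwise linearly independent over
`Z_q`, the design `E_{b*}` is the unique one with `β₃ = 0` among all `E_b`'s: for every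
family of orthonormal polynomials and every `b`, `β₃(E_b) = 0 ↔ b = b*`. -/
theorem statement3 (q m : ℕ) [NeZero q] (hq : q.Prime) (hodd : Odd q) (hq13 : q ≤ 13)
    (hm : 1 ≤ m) (c : Fin m → Fin 2 → ZMod q)
    (hindep : ∀ col1 col2 : Fin 2 ⊕ Fin m, col1 ≠ col2 →
      ∀ a1 a2 : ZMod q,
        (∀ j, a1 * coeffVec c col1 j + a2 * coeffVec c col2 j = 0) → a1 = 0 ∧ a2 = 0)
    (p : ℕ → Polynomial ℝ) (hp : IsOrthonormalFamily q p)
    (b : Fin m → ZMod q) :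
    betaWL q p 3 (Eb c b) = 0 ↔ b = bstar c := by
  have hf := qfacts q hq hodd hq13
  have hne1 : Fact (1 < q) := ⟨hq.one_lt⟩
  constructor
  · refine beta_conv hf hq.one_lt c ?_ p hp b
    intro i j hij
    fin_cases j
    · have := (hindep (Sum.inl 1) (Sum.inr i) (by simp) (- c i 1) 1 (by
        intro j
        fin_cases j
        · simpa [coeffVec] using hij
        · simp [coeffVec])).2
      exact one_ne_zero this
    · have := (hindep (Sum.inl 0) (Sum.inr i) (by simp) (- c i 0) 1 (by
        intro j
        fin_cases j
        · simp [coeffVec]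
        · simpa [coeffVec] using hij)).2
      exact one_ne_zero this
  · rintro rfl
    exact beta_zero hf c p hp
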